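/- arXiv:2504.04499 — 2 statements merged into one kernel-verified Lean document; each statement's English description precedes it below -/
import Mathlib

section
/- Let V be a finite type, G a simple graph on V, s, t : V, m : ℕ, and ι an injective map from the edge set of G into Fin m. Suppose there exists at least one path in G from s to t. Then there exists a path p from s to t such that every path q from s to t whose set of traversed edges differs from that of p satisfies W(p) < W(q), where W(p) = ∑_{e ∈ edges of p} 2^(ι e : ℕ). In particular, a path of minimum binary weight from s to t exists and is unique. -/
/-- The binary weight of a path `p`, given an edge labeling `ι` into `Fin m`:
`W p = ∑_{e ∈ edges of p} 2 ^ (ι e)`. -/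
def pathWeight {V : Type*} [Fintype V] [DecidableEq V] {G : SimpleGraph V}
    [DecidableRel G.Adj] {s t : V} {m : ℕ} (ι : G.edgeSet → Fin m)
    (p : G.Path s t) : ℕ :=
  ∑ e ∈ Finset.univ.filter (fun e : G.edgeSet => (e : Sym2 V) ∈ p.1.edges),
    2 ^ ((ι e : Fin m) : ℕ)

/-- Sums of powers of two with distinct exponents determine the index set. -/
theorem sum_two_pow_comp_injective {α : Type*} {f : α → ℕ} (hf : Function.Injective f) :
    Function.Injective fun A : Finset α => ∑ a ∈ A, 2 ^ f a := by
  intro A B h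
  apply Finset.map_injective ⟨f, hf⟩
  apply Finset.geomSum_injective le_rfl
  simpa [Finset.sum_map] using h

/-- The binary weight of a path determines its set of edges. -/
theorem mem_edges_iff_of_pathWeight_eq {V : Type*} [Fintype V] [DecidableEq V]
    {G : SimpleGraph V} [DecidableRel G.Adj] {s t : V} {m : ℕ} {ι : G.edgeSet → Fin m}
    (hι : Function.Injective ι) {p q : G.Path s t} (h : pathWeight ι p = pathWeight ι q)
    (e : Sym2 V) : e ∈ p.1.edges ↔ e ∈ q.1.edges := by
  have hset := sum_two_pow_comp_injective (Fin.val_injective.comp hι) h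
  by_cases he : e ∈ G.edgeSet
  · simpa using Finset.ext_iff.mp hset ⟨e, he⟩
  · exact iff_of_false (fun hp => he (p.1.edges_subset_edgeSet hp))
      (fun hq => he (q.1.edges_subset_edgeSet hq))

theorem stmt_11 {V : Type*} [Fintype V] [DecidableEq V] (G : SimpleGraph V)
    [DecidableRel G.Adj] (s t : V) (m : ℕ) (ι : G.edgeSet → Fin m)
    (hι : Function.Injective ι) (hpath : Nonempty (G.Path s t)) :
    ∃ p : G.Path s t, ∀ q : G.Path s t,
      {e : Sym2 V | e ∈ q.1.edges} ≠ {e : Sym2 V | e ∈ p.1.edges} →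
      pathWeight ι p < pathWeight ι q := by
  refine ⟨Function.argmin (pathWeight ι), fun q hq =>
    lt_of_le_of_ne (Function.argmin_le (pathWeight ι) q) fun h => hq ?_⟩
  ext e
  exact (mem_edges_iff_of_pathWeight_eq hι h e).symm
end

section
/- Let V be a finite type, G a simple graph on V, s, t : V, m : ℕ, and ι an injective map from the edge set of G into Fin m. Call a binary vector X : Fin m → Bool a path vector if the set of indices where X is true equals the set of labels ι e of the edges e of some path (walk without repeated vertices) in G from s to t. Suppose P₀ is a path vector with val(P) ≤ val(P₀) for every path vector P, where val(X) = ∑_{i : X i = true} 2^(i : ℕ). Then no binary vector X with P₀ ≪ X in the BAT order is a path vector. -/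
/-- The BAT (Binary-Addition-Tree) order on binary vectors: `X ≪ Y` iff there is an
index `i` with `X i = false`, `Y i = true`, and `X j = Y j` for all `j > i`. -/
def batLt {m : ℕ} (X Y : Fin m → Bool) : Prop :=
  ∃ i : Fin m, X i = false ∧ Y i = true ∧ ∀ j : Fin m, i < j → X j = Y j

/-- The binary value of a binary vector: `val X = ∑_{i : X i = true} 2 ^ i`. -/
def val {m : ℕ} (X : Fin m → Bool) : ℕ :=
  ∑ i ∈ Finset.univ.filter (fun i : Fin m => X i = true), 2 ^ (i : ℕ)

/-- `X` is a path vector if its set of true indices equals the set of labels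
`ι e` of the edges `e` of some simple `s`–`t` path in `G`. -/
def IsPathVector {V : Type*} (G : SimpleGraph V) (s t : V) {m : ℕ}
    (ι : G.edgeSet → Fin m) (X : Fin m → Bool) : Prop :=
  ∃ p : G.Path s t, ∀ i : Fin m,
    X i = true ↔ ∃ e : G.edgeSet, ι e = i ∧ (e : Sym2 V) ∈ p.1.edges

/-- The binary value is strictly monotone with respect to the BAT order. -/
theorem val_lt_val_of_batLt {m : ℕ} {X Y : Fin m → Bool} (h : batLt X Y) : val X < val Y := by
  obtain ⟨i, hX, hY, hXY⟩ := h
  let A := Finset.univ.filter fun j : Fin m => X j = true ∧ j < i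
  let B := Finset.univ.filter fun j : Fin m => X j = true ∧ i < j
  have hA : ∑ j ∈ A, 2 ^ (j : ℕ) < 2 ^ (i : ℕ) := by
    have := Nat.geomSum_lt (m := 2) (n := i) (s := A.map Fin.valEmbedding) le_rfl
      (by simpa [A] using fun k j _ hji hk => hk ▸ hji)
    simpa using this
  have hiB : i ∉ B := by simp [B]
  have hAB : Disjoint A B := by
    rw [Finset.disjoint_left]
    intro j hj hj'
    simp only [A, B, Finset.mem_filter] at hj hj'
    exact lt_asymm hj.2.2 hj'.2.2
  calc val X ≤ ∑ j ∈ A ∪ B, 2 ^ (j : ℕ) := by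
        refine Finset.sum_le_sum_of_subset fun j hj => ?_
        simp only [A, B, Finset.mem_union, Finset.mem_filter, Finset.mem_univ, true_and] at hj ⊢
        rcases lt_trichotomy j i with hji | rfl | hij
        · exact Or.inl ⟨hj, hji⟩
        · simp [hX] at hj
        · exact Or.inr ⟨hj, hij⟩
    _ = ∑ j ∈ A, 2 ^ (j : ℕ) + ∑ j ∈ B, 2 ^ (j : ℕ) := Finset.sum_union hAB
    _ < 2 ^ (i : ℕ) + ∑ j ∈ B, 2 ^ (j : ℕ) := by gcongr
    _ = ∑ j ∈ insert i B, 2 ^ (j : ℕ) := by rw [Finset.sum_insert hiB]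
    _ ≤ val Y := by
        refine Finset.sum_le_sum_of_subset fun j hj => ?_
        simp only [B, Finset.mem_insert, Finset.mem_filter, Finset.mem_univ, true_and] at hj ⊢
        rcases hj with rfl | ⟨hj, hij⟩
        · exact hY
        · exact hXY j hij ▸ hj

theorem stmt_14 {V : Type*} [Fintype V] (G : SimpleGraph V) (s t : V)
    (m : ℕ) (ι : G.edgeSet → Fin m) (hι : Function.Injective ι)
    (P₀ : Fin m → Bool) (hP₀ : IsPathVector G s t ι P₀)
    (hmax : ∀ P : Fin m → Bool, IsPathVector G s t ι P → val P ≤ val P₀) :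
    ∀ X : Fin m → Bool, batLt P₀ X → ¬ IsPathVector G s t ι X := by
  intro X hX hP
  exact (val_lt_val_of_batLt hX).not_ge (hmax X hP)
end
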